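/- arXiv:1202.6188 — 3 statements merged into one kernel-verified Lean document; each statement's English description precedes it below -/
import Mathlib

section
/- Let N be a nonnegative progressively measurable process all of whose paths are continuous. If N is a Q-martingale on [0,S), then the process M defined by M_t := (N_t / X_t)·1_{t < R}·1_{0 < X_t < ∞} is a Q̂-local martingale on [0,T]; moreover, Q̂-almost surely on {R ≤ T}, lim_{t→R, t<R} N_t / X_t = 0 (i.e., the extension of N/X to the closed interval [0,R] takes the value 0 at R). -/
open MeasureTheory Filter Set Topology
open scoped ENNReal NNReal

noncomputable section

namespace Paper

/-- `τ` is a stopping time with respect to the raw filtration `F`,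
taking values in `[0,T] ∪ {T+1}`. -/
def IsStopT {Ω : Type*} (F : ℝ → MeasurableSpace Ω) (T : ℝ) (τ : Ω → ℝ) : Prop :=
  (∀ t : ℝ, MeasurableSet[F t] {ω | τ ω ≤ t}) ∧ ∀ ω, τ ω ∈ Icc (0:ℝ) T ∪ {T + 1}

/-- `A ∈ F_τ`, the σ-algebra associated with the stopping time `τ`. -/
def MemFtau {Ω : Type*} (F : ℝ → MeasurableSpace Ω) (τ : Ω → ℝ) (A : Set Ω) : Prop :=
  ∀ t : ℝ, MeasurableSet[F t] (A ∩ {ω | τ ω ≤ t})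

/-- the σ-algebra `F_τ` of a stopping time `τ` (for a stopping time the generating
family below is already a σ-algebra, so this is exactly the usual `F_τ`). -/
def sigmaAt {Ω : Type*} (F : ℝ → MeasurableSpace Ω) (τ : Ω → ℝ) : MeasurableSpace Ω :=
  MeasurableSpace.generateFrom {A | MemFtau F τ A}

/-- the stopped process `N^τ`, i.e. `N^τ_t := N_{t ∧ τ ∧ T}`. -/
def stopped {Ω : Type*} (T : ℝ) (N : ℝ → Ω → ℝ≥0∞) (τ : Ω → ℝ) : ℝ → Ω → ℝ≥0∞ :=
  fun t ω => N (min t (min (τ ω) T)) ω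

/-- the value of a process at a stopping time, `N_τ := N_{τ ∧ T}`. -/
def valueAt {Ω : Type*} (T : ℝ) (N : ℝ → Ω → ℝ≥0∞) (τ : Ω → ℝ) : Ω → ℝ≥0∞ :=
  fun ω => N (min (τ ω) T) ω

/-- `N` is a `P`-martingale on the time horizon `[0,T]`: it is adapted, `P`-integrable, and
satisfies `E^P[N_t ∣ F_s] = N_s` for all `0 ≤ s ≤ t ≤ T`.  For nonnegative
(`ℝ≥0∞`-valued) integrable adapted processes the conditional-expectation identity is
equivalent to the defining set-integral identity used here. -/
def IsMart {Ω : Type*} (F : ℝ → MeasurableSpace Ω) (T : ℝ) (P : @Measure Ω (F T))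
    (N : ℝ → Ω → ℝ≥0∞) : Prop :=
  (∀ t ∈ Icc (0:ℝ) T, Measurable[F t] (N t)) ∧
  (∀ t ∈ Icc (0:ℝ) T, ∫⁻ ω, N t ω ∂P ≠ ⊤) ∧
  ∀ s t : ℝ, 0 ≤ s → s ≤ t → t ≤ T → ∀ A : Set Ω, MeasurableSet[F s] A →
    ∫⁻ ω in A, N t ω ∂P = ∫⁻ ω in A, N s ω ∂P

/-- `N` is a `P`-local martingale on `[0,T]`. -/
def IsLocMart {Ω : Type*} (F : ℝ → MeasurableSpace Ω) (T : ℝ) (P : @Measure Ω (F T))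
    (N : ℝ → Ω → ℝ≥0∞) : Prop :=
  ∃ τ : ℕ → Ω → ℝ, (∀ n, IsStopT F T (τ n)) ∧ (∀ n ω, τ n ω ≤ τ (n + 1) ω) ∧
    P {ω | ∀ᶠ n in atTop, τ n ω = T + 1} = 1 ∧
    ∀ n, IsMart F T P (stopped T N (τ n))

/-- `N` is a `P`-local martingale on the stochastic interval `[0,τ)`. -/
def IsLocMartBefore {Ω : Type*} (F : ℝ → MeasurableSpace Ω) (T : ℝ) (P : @Measure Ω (F T))
    (N : ℝ → Ω → ℝ≥0∞) (τ : Ω → ℝ) : Prop :=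
  ∀ σ : Ω → ℝ, IsStopT F T σ → (∀ᵐ ω ∂P, σ ω < τ ω) → IsLocMart F T P (stopped T N σ)

/-- `N` is a `P`-martingale on the stochastic interval `[0,τ)`. -/
def IsMartBefore {Ω : Type*} (F : ℝ → MeasurableSpace Ω) (T : ℝ) (P : @Measure Ω (F T))
    (N : ℝ → Ω → ℝ≥0∞) (τ : Ω → ℝ) : Prop :=
  ∀ σ : Ω → ℝ, IsStopT F T σ → (∀ᵐ ω ∂P, σ ω < τ ω) → IsMart F T P (stopped T N σ)

/-- the first time in `[0,T]` at which `X` is `≥ c`; equal to `T+1` if this never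
happens (`inf ∅ := T+1`). -/
def hitAbove {Ω : Type*} (T : ℝ) (X : ℝ → Ω → ℝ≥0∞) (c : ℝ≥0∞) (ω : Ω) : ℝ :=
  sInf ({t ∈ Icc (0:ℝ) T | c ≤ X t ω} ∪ {T + 1})

/-- the first time in `[0,T]` at which `X` is `≤ c`; equal to `T+1` if this never
happens (`inf ∅ := T+1`). -/
def hitBelow {Ω : Type*} (T : ℝ) (X : ℝ → Ω → ℝ≥0∞) (c : ℝ≥0∞) (ω : Ω) : ℝ :=
  sInf ({t ∈ Icc (0:ℝ) T | X t ω ≤ c} ∪ {T + 1})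

/-- `R = lim_i R_i` where `R_i = inf {t ∈ [0,T] : X_t ≥ i}` (explosion time of `X`);
the nondecreasing limit is the supremum. -/
def Rt {Ω : Type*} (T : ℝ) (X : ℝ → Ω → ℝ≥0∞) (ω : Ω) : ℝ :=
  ⨆ i : ℕ, hitAbove T X (i : ℝ≥0∞) ω

/-- `S = lim_i S_i` where `S_i = inf {t ∈ [0,T] : X_t ≤ 1/i}` (hitting time of `0`);
the nondecreasing limit is the supremum. -/
def St {Ω : Type*} (T : ℝ) (X : ℝ → Ω → ℝ≥0∞) (ω : Ω) : ℝ :=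
  ⨆ i : ℕ, hitBelow T X ((i : ℝ≥0∞))⁻¹ ω

/-- The standing assumptions: `0 < T`; `(F_t)` is a (monotone) filtration that is
right-continuous on `[0,T)`; `X` is adapted with continuous `[0,∞]`-valued paths absorbed
at `0` and `∞`; `x₀ ∈ (0,∞)`; `Q` is a probability measure on `F_T` with
`Q(R = T+1) = 1`, `Q(X_0 = x₀) = 1` and `X` a `Q`-local martingale. -/
structure Setup {Ω : Type*} (F : ℝ → MeasurableSpace Ω) (T : ℝ) (X : ℝ → Ω → ℝ≥0∞)
    (x₀ : ℝ≥0∞) (Q : @Measure Ω (F T)) : Prop where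
  T_pos : 0 < T
  mono : ∀ s t : ℝ, s ≤ t → F s ≤ F t
  rightCont : ∀ t ∈ Ico (0:ℝ) T, F t = ⨅ s ∈ Ioc t T, F s
  prob : IsProbabilityMeasure Q
  adapted : ∀ t ∈ Icc (0:ℝ) T, Measurable[F t] (X t)
  contPaths : ∀ ω, ContinuousOn (fun t => X t ω) (Icc 0 T)
  absorbing : ∀ ω, ∀ t ∈ Icc (0:ℝ) T, (X t ω = 0 ∨ X t ω = ⊤) →
    ∀ s ∈ Icc t T, X s ω = X t ω
  x₀_pos : 0 < x₀
  x₀_lt_top : x₀ < ⊤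
  noExplosion : Q {ω | Rt T X ω = T + 1} = 1
  init : Q {ω | X 0 ω = x₀} = 1
  locMart : IsLocMart F T Q X

/-- The numéraire relation between `Q` and `Q̂`: for every stopping time `τ` with values
in `[0,T] ∪ {T+1}` and every `A ∈ F_τ`,
`Q̂(A ∩ {X_τ < ∞}) = (1/x₀)·E^Q[1_A · X_τ]` (with `X_τ := X_{τ ∧ T}`). -/
def NumeraireRel {Ω : Type*} (F : ℝ → MeasurableSpace Ω) (T : ℝ) (X : ℝ → Ω → ℝ≥0∞)
    (x₀ : ℝ≥0∞) (Q Qh : @Measure Ω (F T)) : Prop :=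
  ∀ τ : Ω → ℝ, IsStopT F T τ → ∀ A : Set Ω, MemFtau F τ A →
    Qh (A ∩ {ω | valueAt T X τ ω < ⊤}) = (∫⁻ ω in A, valueAt T X τ ω ∂Q) / x₀

/-- progressive measurability of `N` with respect to the raw filtration `F` on `[0,T]`. -/
def ProgMeas {Ω : Type*} (F : ℝ → MeasurableSpace Ω) (T : ℝ)
    (N : ℝ → Ω → ℝ≥0∞) : Prop :=
  ∀ t ∈ Icc (0:ℝ) T,
    @Measurable (Icc (0:ℝ) t × Ω) ℝ≥0∞ (@Prod.instMeasurableSpace _ _ _ (F t)) _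
      (fun p => N p.1 p.2)

section Helpers

variable {Ω : Type*} {F : ℝ → MeasurableSpace Ω} {T : ℝ}

/-! ### Hitting times of closed sets -/

/-- The first time in `[0,T]` at which `Z` is in `C`, and `T + 1` if this never happens. -/
def hitSet {E : Type*} (T : ℝ) (Z : ℝ → Ω → E) (C : Set E) (ω : Ω) : ℝ :=
  sInf ({t ∈ Icc (0:ℝ) T | Z t ω ∈ C} ∪ {T + 1})

section Hit

variable {E : Type*} {Z : ℝ → Ω → E} {C : Set E} {ω : Ω}

lemma bddBelow_hitSet (hT : 0 < T) : BddBelow ({t ∈ Icc (0:ℝ) T | Z t ω ∈ C} ∪ {T + 1}) := by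
  refine ⟨0, ?_⟩
  rintro t (ht | rfl)
  · exact ht.1.1
  · linarith

lemma hitSet_le (hT : 0 < T) {t : ℝ} (ht : t ∈ Icc 0 T) (h : Z t ω ∈ C) : hitSet T Z C ω ≤ t :=
  csInf_le (bddBelow_hitSet hT) (Or.inl ⟨ht, h⟩)

lemma hitSet_le_add_one (hT : 0 < T) : hitSet T Z C ω ≤ T + 1 :=
  csInf_le (bddBelow_hitSet hT) (Or.inr rfl)

variable [TopologicalSpace E]

lemma hitSet_spec (hT : 0 < T) (hZ : ContinuousOn (fun t => Z t ω) (Icc 0 T)) (hC : IsClosed C) :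
    (hitSet T Z C ω ∈ Icc 0 T ∧ Z (hitSet T Z C ω) ω ∈ C) ∨ hitSet T Z C ω = T + 1 := by
  have hcl : IsClosed ({t ∈ Icc (0:ℝ) T | Z t ω ∈ C} ∪ {T + 1}) :=
    (hZ.preimage_isClosed_of_isClosed isClosed_Icc hC).union isClosed_singleton
  exact hcl.csInf_mem ⟨T + 1, Or.inr rfl⟩ (bddBelow_hitSet hT)

lemma hitSet_le_iff (hT : 0 < T) (hZ : ContinuousOn (fun t => Z t ω) (Icc 0 T)) (hC : IsClosed C)
    {t : ℝ} (ht : t ≤ T) : hitSet T Z C ω ≤ t ↔ ∃ s ∈ Icc 0 t, Z s ω ∈ C := by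
  constructor
  · intro h
    rcases hitSet_spec hT hZ hC with ⟨h1, h2⟩ | h1
    · exact ⟨_, ⟨h1.1, h⟩, h2⟩
    · linarith
  · rintro ⟨s, hs, hsC⟩
    exact (hitSet_le hT ⟨hs.1, hs.2.trans ht⟩ hsC).trans hs.2

lemma measurableSet_exists_mem [TopologicalSpace.MetrizableSpace E] [MeasurableSpace E]
    [BorelSpace E] [MeasurableSpace Ω] {t : ℝ} (ht : 0 ≤ t)
    (hm : ∀ s ∈ Icc 0 t, Measurable (Z s))
    (hZ : ∀ ω, ContinuousOn (fun s => Z s ω) (Icc 0 t)) (hC : IsClosed C) :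
    MeasurableSet {ω | ∃ s ∈ Icc 0 t, Z s ω ∈ C} := by
  let _ := TopologicalSpace.metrizableSpaceMetric E
  obtain ⟨D, hDc, hDd⟩ := TopologicalSpace.exists_countable_dense (Icc (0:ℝ) t)
  have hne : Nonempty (Icc (0:ℝ) t) := ⟨⟨0, le_rfl, ht⟩⟩
  have hcont : ∀ ω, Continuous fun s : Icc (0:ℝ) t => Metric.infEDist (Z s ω) C := fun ω =>
    Metric.continuous_infEDist.comp (hZ ω).domRestrict
  have key : {ω | ∃ s ∈ Icc 0 t, Z s ω ∈ C} =
      ⋂ k : ℕ, ⋃ q ∈ D, {ω | Metric.infEDist (Z (q : ℝ) ω) C < ((k : ℝ≥0∞) + 1)⁻¹} := by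
    ext ω
    simp only [mem_ofPred_eq, mem_iInter, mem_iUnion, exists_prop]
    constructor
    · rintro ⟨s, hs, hsC⟩ k
      have h0 : Metric.infEDist (Z s ω) C = 0 := Metric.infEDist_zero_of_mem hsC
      have hopen : IsOpen {s : Icc (0:ℝ) t |
          Metric.infEDist (Z s ω) C < ((k : ℝ≥0∞) + 1)⁻¹} :=
        isOpen_lt (hcont ω) continuous_const
      obtain ⟨q, hqD, hq⟩ := hDd.exists_mem_open hopen ⟨⟨s, hs⟩, by
        simp only [mem_ofPred_eq, h0]
        exact ENNReal.inv_pos.2 (by finiteness)⟩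
      exact ⟨q, hqD, hq⟩
    · intro h
      obtain ⟨s, -, hs⟩ := isCompact_univ.exists_isMinOn univ_nonempty (hcont ω).continuousOn
      refine ⟨s, s.2, ?_⟩
      rw [Metric.mem_iff_infEDist_zero_of_closed hC]
      by_contra hne0
      obtain ⟨k, hk⟩ := ENNReal.exists_inv_nat_lt hne0
      obtain ⟨q, -, hq⟩ := h k
      have h1 : Metric.infEDist (Z s ω) C ≤ Metric.infEDist (Z q ω) C := hs (mem_univ q)
      have h2 : ((k : ℝ≥0∞) + 1)⁻¹ ≤ (k : ℝ≥0∞)⁻¹ := ENNReal.inv_le_inv.2 le_self_add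
      exact absurd (h1.trans_lt (hq.trans_le h2)) hk.le.not_gt
  rw [key]
  refine MeasurableSet.iInter fun k => MeasurableSet.biUnion hDc fun q _ => ?_
  exact measurableSet_lt (Metric.continuous_infEDist.measurable.comp (hm q q.2)) measurable_const

lemma isStopT_hitSet [TopologicalSpace.MetrizableSpace E] [MeasurableSpace E] [BorelSpace E]
    (hT : 0 < T) (hF : ∀ s t : ℝ, s ≤ t → F s ≤ F t)
    (hm : ∀ t ∈ Icc (0:ℝ) T, Measurable[F t] (Z t))
    (hZ : ∀ ω, ContinuousOn (fun s => Z s ω) (Icc 0 T)) (hC : IsClosed C) :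
    IsStopT F T (hitSet T Z C) := by
  have hle : ∀ t ∈ Icc (0:ℝ) T, MeasurableSet[F t] {ω | hitSet T Z C ω ≤ t} := by
    intro t ht
    simp_rw [fun ω => hitSet_le_iff hT (hZ ω) hC ht.2]
    let _ := F t
    exact measurableSet_exists_mem ht.1
      (fun s hs => (hm s ⟨hs.1, hs.2.trans ht.2⟩).mono (hF s t hs.2) le_rfl)
      (fun ω => (hZ ω).mono (Icc_subset_Icc_right ht.2)) hC
  have hval : ∀ ω, hitSet T Z C ω ∈ Icc (0:ℝ) T ∪ {T + 1} := fun ω =>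
    (hitSet_spec hT (hZ ω) hC).imp (fun h => h.1) id
  refine ⟨fun t => ?_, hval⟩
  rcases lt_or_ge t 0 with ht | ht
  · convert @MeasurableSet.empty Ω (F t)
    ext ω
    have : 0 ≤ hitSet T Z C ω := by
      rcases hval ω with h | h
      · exact h.1
      · rw [mem_singleton_iff.1 h]; linarith
    simp only [mem_ofPred_eq, mem_empty_iff_false, iff_false, not_le]
    linarith
  rcases le_or_gt t T with htT | htT
  · exact hle t ⟨ht, htT⟩
  rcases lt_or_ge t (T + 1) with ht1 | ht1
  · convert hF T t htT.le _ (hle T ⟨hT.le, le_rfl⟩) using 1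
    ext ω
    simp only [mem_ofPred_eq]
    rcases hval ω with h | h
    · exact ⟨fun _ => h.2, fun h' => h'.trans htT.le⟩
    · rw [mem_singleton_iff.1 h]
      constructor <;> intro <;> linarith
  · convert @MeasurableSet.univ Ω (F t)
    ext ω
    simpa using (hitSet_le_add_one hT).trans ht1

end Hit

/-! ### Stopping times and progressive measurability -/

lemma IsStopT.nonneg (hT : 0 < T) {τ : Ω → ℝ} (hτ : IsStopT F T τ) (ω : Ω) : 0 ≤ τ ω := by
  rcases hτ.2 ω with h | h
  · exact h.1
  · rw [mem_singleton_iff.1 h]; linarith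

lemma isStopT_const {t : ℝ} (ht : t ∈ Icc 0 T) : IsStopT F T fun _ => t :=
  ⟨fun s => by let _ := F s; exact MeasurableSet.const _, fun _ => Or.inl ht⟩

lemma IsStopT.min {σ τ : Ω → ℝ} (hσ : IsStopT F T σ) (hτ : IsStopT F T τ) :
    IsStopT F T fun ω => min (σ ω) (τ ω) := by
  refine ⟨fun t => ?_, fun ω => ?_⟩
  · simp_rw [min_le_iff, ofPred_or]
    exact (hσ.1 t).union (hτ.1 t)
  · rcases min_choice (σ ω) (τ ω) with h | h
    · exact h.symm.subst (motive := (· ∈ Icc (0:ℝ) T ∪ {T + 1})) (hσ.2 ω)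
    · exact h.symm.subst (motive := (· ∈ Icc (0:ℝ) T ∪ {T + 1})) (hτ.2 ω)

/-- The σ-algebra of events prior to `τ`. -/
@[reducible]
def stopSigma (F : ℝ → MeasurableSpace Ω) (τ : Ω → ℝ)
    (h : ∀ t : ℝ, MeasurableSet[F t] {ω | τ ω ≤ t}) : MeasurableSpace Ω where
  MeasurableSet' := MemFtau F τ
  measurableSet_empty t := by simp
  measurableSet_compl A hA t := by
    have : Aᶜ ∩ {ω | τ ω ≤ t} = {ω | τ ω ≤ t} \ (A ∩ {ω | τ ω ≤ t}) := by
      ext ω; simp only [mem_inter_iff, mem_compl_iff, Set.mem_sdiff]; tauto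
    rw [this]
    exact (h t).diff (hA t)
  measurableSet_iUnion f hf t := by
    rw [iUnion_inter]
    exact MeasurableSet.iUnion fun i => hf i t

lemma stopSigma_le {τ : Ω → ℝ} (h : ∀ t : ℝ, MeasurableSet[F t] {ω | τ ω ≤ t})
    (hτT : ∀ ω, τ ω ≤ T) : stopSigma F τ h ≤ F T := fun A hA => by
  simpa [hτT] using hA T

lemma ProgMeas.measurable_min (hT : 0 < T) (hF : ∀ s t : ℝ, s ≤ t → F s ≤ F t)
    {Y : ℝ → Ω → ℝ≥0∞} (hY : ProgMeas F T Y) {τ : Ω → ℝ} (hτ : IsStopT F T τ) {t : ℝ}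
    (ht : t ∈ Icc 0 T) : Measurable[F t] fun ω => Y (min t (τ ω)) ω := by
  let _ := F t
  have hmin : Measurable fun ω => min t (τ ω) := by
    refine measurable_of_Iic fun s => ?_
    rcases le_or_gt t s with h | h
    · convert MeasurableSet.univ (α := Ω)
      ext ω
      simp [h]
    · convert hF s t h.le _ (hτ.1 s) using 1
      ext ω
      simp [h]
  have hpair : Measurable fun ω =>
      ((⟨min t (τ ω), le_min ht.1 (hτ.nonneg hT ω), min_le_left _ _⟩ : Icc (0:ℝ) t), ω) :=
    (hmin.subtype_mk).prodMk measurable_id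
  exact (hY t ht).comp hpair

lemma ProgMeas.adapted (hT : 0 < T) (hF : ∀ s t : ℝ, s ≤ t → F s ≤ F t)
    {Y : ℝ → Ω → ℝ≥0∞} (hY : ProgMeas F T Y) {t : ℝ} (ht : t ∈ Icc 0 T) :
    Measurable[F t] (Y t) := by
  simpa using hY.measurable_min hT hF (isStopT_const ht) ht

lemma progMeas_of_continuousOn (hF : ∀ s t : ℝ, s ≤ t → F s ≤ F t)
    {Y : ℝ → Ω → ℝ≥0∞} (hm : ∀ t ∈ Icc (0:ℝ) T, Measurable[F t] (Y t))
    (hY : ∀ ω, ContinuousOn (fun s => Y s ω) (Icc 0 T)) : ProgMeas F T Y := by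
  intro t ht
  let _ := F t
  exact measurable_uncurry_of_continuous_of_measurable (u := fun (s : Icc (0:ℝ) t) ω => Y s ω)
    (fun ω => ((hY ω).mono (Icc_subset_Icc_right ht.2)).domRestrict)
    (fun s => (hm s ⟨s.2.1, s.2.2.trans ht.2⟩).mono (hF s t s.2.2) le_rfl)

lemma ProgMeas.measurable_valueAt (hT : 0 < T) (hF : ∀ s t : ℝ, s ≤ t → F s ≤ F t)
    {Y : ℝ → Ω → ℝ≥0∞} (hY : ProgMeas F T Y) {τ : Ω → ℝ} (hτ : IsStopT F T τ)
    (hτT : ∀ ω, τ ω ≤ T) : Measurable[stopSigma F τ hτ.1] (valueAt T Y τ) := by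
  intro B hB t
  rcases lt_or_ge t 0 with ht | ht
  · convert @MeasurableSet.empty Ω (F t)
    ext ω
    have := hτ.nonneg hT ω
    simp only [mem_inter_iff, mem_ofPred_eq, mem_empty_iff_false, iff_false, not_and, not_le]
    intro _; linarith
  have hmeas : MeasurableSet[F (min t T)]
      ((fun ω => Y (min (min t T) (τ ω)) ω) ⁻¹' B ∩ {ω | τ ω ≤ min t T}) :=
    @MeasurableSet.inter _ (F (min t T)) _ _
      (hY.measurable_min hT hF hτ ⟨le_min ht hT.le, min_le_right _ _⟩ hB) (hτ.1 _)
  convert hF _ _ (min_le_left t T) _ hmeas using 1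
  ext ω
  simp only [mem_inter_iff, mem_preimage, mem_ofPred_eq, valueAt, le_min_iff, hτT ω, and_true,
    min_eq_left (hτT ω)]
  refine and_congr_left fun h => ?_
  rw [min_eq_right (le_min h (hτT ω))]

/-! ### Paths absorbed at zero and infinity -/

section Paths

variable {X : ℝ → Ω → ℝ≥0∞} {x₀ : ℝ≥0∞} {Q Qh : @Measure Ω (F T)} {ω : Ω}

lemma Setup.lt_top_of_le (hs : Setup F T X x₀ Q) {s t : ℝ} (h0 : 0 ≤ s) (hst : s ≤ t)
    (ht : t ≤ T) (h : X t ω < ⊤) : X s ω < ⊤ := by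
  by_contra hc
  rw [not_lt_top_iff] at hc
  rw [hs.absorbing ω s ⟨h0, hst.trans ht⟩ (Or.inr hc) t ⟨hst, ht⟩, hc] at h
  exact lt_irrefl _ h

lemma Setup.pos_of_le (hs : Setup F T X x₀ Q) {s t : ℝ} (h0 : 0 ≤ s) (hst : s ≤ t)
    (ht : t ≤ T) (h : 0 < X t ω) : 0 < X s ω := by
  by_contra hc
  rw [not_lt, nonpos_iff_eq_zero] at hc
  rw [hs.absorbing ω s ⟨h0, hst.trans ht⟩ (Or.inl hc) t ⟨hst, ht⟩, hc] at h
  exact lt_irrefl _ h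

lemma Setup.exists_nat_gt (hs : Setup F T X x₀ Q) {t : ℝ} (ht : t ∈ Icc 0 T) (h : X t ω < ⊤) :
    ∃ k : ℕ, ∀ s ∈ Icc 0 t, X s ω < k := by
  obtain ⟨u, hu, hmax⟩ := isCompact_Icc.exists_isMaxOn (nonempty_Icc.2 ht.1)
    ((hs.contPaths ω).mono (Icc_subset_Icc_right ht.2))
  obtain ⟨k, hk⟩ := ENNReal.exists_nat_gt (hs.lt_top_of_le hu.1 hu.2 ht.2 h).ne
  exact ⟨k, fun s hst => (hmax hst).trans_lt hk⟩

lemma Setup.exists_inv_nat_lt (hs : Setup F T X x₀ Q) {t : ℝ} (ht : t ∈ Icc 0 T)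
    (h : 0 < X t ω) : ∃ k : ℕ, ∀ s ∈ Icc 0 t, (k : ℝ≥0∞)⁻¹ < X s ω := by
  obtain ⟨u, hu, hmin⟩ := isCompact_Icc.exists_isMinOn (nonempty_Icc.2 ht.1)
    ((hs.contPaths ω).mono (Icc_subset_Icc_right ht.2))
  obtain ⟨k, hk⟩ := ENNReal.exists_inv_nat_lt (hs.pos_of_le hu.1 hu.2 ht.2 h).ne'
  exact ⟨k, fun s hst => hk.trans_le (hmin hst)⟩

lemma Setup.lt_hitBelow (hs : Setup F T X x₀ Q) {t : ℝ} (ht : t ∈ Icc 0 T) {c : ℝ≥0∞}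
    (h : ∀ s ∈ Icc 0 t, c < X s ω) : t < hitBelow T X c ω := by
  by_contra! hc
  obtain ⟨s, hst, hsc⟩ := (hitSet_le_iff hs.T_pos (hs.contPaths ω) isClosed_Iic ht.2).1 hc
  exact (h s hst).not_ge hsc

lemma Setup.lt_hitAbove (hs : Setup F T X x₀ Q) {t : ℝ} (ht : t ∈ Icc 0 T) {c : ℝ≥0∞}
    (h : ∀ s ∈ Icc 0 t, X s ω < c) : t < hitAbove T X c ω := by
  by_contra! hc
  obtain ⟨s, hst, hsc⟩ := (hitSet_le_iff hs.T_pos (hs.contPaths ω) isClosed_Ici ht.2).1 hc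
  exact (h s hst).not_ge hsc

lemma Setup.isStopT_hitBelow (hs : Setup F T X x₀ Q) (c : ℝ≥0∞) :
    IsStopT F T (hitBelow T X c) :=
  isStopT_hitSet hs.T_pos hs.mono hs.adapted hs.contPaths isClosed_Iic

lemma Setup.hitAbove_le_Rt (hs : Setup F T X x₀ Q) (i : ℕ) :
    hitAbove T X (i : ℝ≥0∞) ω ≤ Rt T X ω :=
  le_ciSup (f := fun i : ℕ => hitAbove T X (i : ℝ≥0∞) ω)
    ⟨T + 1, by rintro _ ⟨i, rfl⟩; exact hitSet_le_add_one (C := Ici (i : ℝ≥0∞)) hs.T_pos⟩ i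

lemma Setup.lt_Rt (hs : Setup F T X x₀ Q) {t : ℝ} (ht : t ∈ Icc 0 T) (h : X t ω < ⊤) :
    t < Rt T X ω := by
  obtain ⟨k, hk⟩ := hs.exists_nat_gt ht h
  exact (hs.lt_hitAbove ht hk).trans_le (hs.hitAbove_le_Rt k)

lemma Setup.lt_St (hs : Setup F T X x₀ Q) {t : ℝ} (ht : t ∈ Icc 0 T) (h : 0 < X t ω) :
    t < St T X ω := by
  obtain ⟨k, hk⟩ := hs.exists_inv_nat_lt ht h
  exact (hs.lt_hitBelow ht hk).trans_le
    (le_ciSup (f := fun i : ℕ => hitBelow T X ((i : ℝ≥0∞))⁻¹ ω)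
      ⟨T + 1, by rintro _ ⟨i, rfl⟩; exact hitSet_le_add_one (C := Iic (i : ℝ≥0∞)⁻¹) hs.T_pos⟩ k)

lemma Setup.Rt_le (hs : Setup F T X x₀ Q) {t : ℝ} (ht : t ∈ Icc 0 T) (h : X t ω = ⊤) :
    Rt T X ω ≤ t :=
  ciSup_le fun i => hitSet_le (Z := X) (C := Ici (i : ℝ≥0∞)) hs.T_pos ht (by simp [h])

lemma Setup.Rt_nonneg (hs : Setup F T X x₀ Q) : 0 ≤ Rt T X ω := by
  refine le_trans ?_ (hs.hitAbove_le_Rt 0)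
  rcases hitSet_spec hs.T_pos (hs.contPaths ω) (isClosed_Ici (a := ((0 : ℕ) : ℝ≥0∞)))
    with h | h
  · exact h.1.1
  · have := hs.T_pos
    exact le_of_le_of_eq (by linarith) h.symm

lemma Setup.pos_before_hitBelow (hs : Setup F T X x₀ Q) (h0 : 0 < X 0 ω) (n : ℕ) {u : ℝ}
    (hu : u ∈ Icc 0 T) (hun : u ≤ hitBelow T X (n : ℝ≥0∞)⁻¹ ω) : 0 < X u ω := by
  by_contra hc
  rw [not_lt, nonpos_iff_eq_zero] at hc
  have hn : (0 : ℝ≥0∞) < (n : ℝ≥0∞)⁻¹ := ENNReal.inv_pos.2 (by finiteness)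
  rcases le_or_gt (X 0 ω) (n : ℝ≥0∞)⁻¹ with h | h
  · have h1 : hitBelow T X (n : ℝ≥0∞)⁻¹ ω ≤ 0 :=
      hitSet_le (Z := X) (C := Iic (n : ℝ≥0∞)⁻¹) hs.T_pos ⟨le_rfl, hs.T_pos.le⟩ h
    have : u = 0 := le_antisymm (hun.trans h1) hu.1
    rw [this] at hc
    exact h0.ne' hc
  · obtain ⟨s, hsu, hsX⟩ := intermediate_value_Icc' hu.1
      ((hs.contPaths ω).mono (Icc_subset_Icc_right hu.2))
      (⟨hc.le.trans hn.le, h.le⟩ : (n : ℝ≥0∞)⁻¹ ∈ Icc (X u ω) (X 0 ω))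
    have h1 : hitBelow T X (n : ℝ≥0∞)⁻¹ ω ≤ s :=
      hitSet_le (Z := X) (C := Iic (n : ℝ≥0∞)⁻¹) hs.T_pos ⟨hsu.1, hsu.2.trans hu.2⟩ hsX.le
    have : s = u := le_antisymm hsu.2 (hun.trans h1)
    simp only [this, hc] at hsX
    exact hn.ne hsX

lemma Setup.ae_lt_top (hs : Setup F T X x₀ Q) : ∀ᵐ ω ∂Q, X T ω < ⊤ := by
  let _ := F T
  have := hs.prob
  have hT : T ∈ Icc 0 T := ⟨hs.T_pos.le, le_rfl⟩
  have hm : MeasurableSet {ω | X T ω < ⊤} := (hs.adapted T hT) measurableSet_Iio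
  refine (mem_ae_iff_prob_eq_one hm).2 (le_antisymm prob_le_one ?_)
  rw [← hs.noExplosion]
  refine measure_mono fun ω (hω : Rt T X ω = T + 1) => ?_
  by_contra hc
  have := hs.Rt_le hT (not_lt_top_iff.1 hc)
  linarith

lemma Setup.ae_init (hs : Setup F T X x₀ Q) : ∀ᵐ ω ∂Q, 0 < X 0 ω := by
  let _ := F T
  have := hs.prob
  have hm : MeasurableSet {ω | X 0 ω = x₀} :=
    ((hs.adapted 0 ⟨le_rfl, hs.T_pos.le⟩).mono (hs.mono 0 T hs.T_pos.le) le_rfl)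
      (measurableSet_singleton x₀)
  filter_upwards [(mem_ae_iff_prob_eq_one hm).2 hs.init] with ω (hω : X 0 ω = x₀)
  rw [hω]
  exact hs.x₀_pos

lemma Setup.progMeas (hs : Setup F T X x₀ Q) : ProgMeas F T X :=
  progMeas_of_continuousOn hs.mono hs.adapted hs.contPaths

/-! ### Change of measure at a stopping time -/

lemma NumeraireRel.lintegral_eq (hs : Setup F T X x₀ Q) (hnum : NumeraireRel F T X x₀ Q Qh)
    {σ : Ω → ℝ} (hσ : IsStopT F T σ) (hσT : ∀ ω, σ ω ≤ T) {g : Ω → ℝ≥0∞}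
    (hg : Measurable[stopSigma F σ hσ.1] g) :
    ∫⁻ ω in {ω | valueAt T X σ ω < ⊤}, g ω ∂Qh =
      x₀⁻¹ * ∫⁻ ω, valueAt T X σ ω * g ω ∂Q := by
  have hle := stopSigma_le hσ.1 hσT
  have hXm := hs.progMeas.measurable_valueAt hs.T_pos hs.mono hσ hσT
  have hXmT : Measurable[F T] (valueAt T X σ) := hXm.mono hle le_rfl
  have heq : (Qh.restrict {ω | valueAt T X σ ω < ⊤}).trim hle =
      (x₀⁻¹ • Q.withDensity (valueAt T X σ)).trim hle := by
    refine @Measure.ext _ (stopSigma F σ hσ.1) _ _ fun A hA => ?_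
    rw [trim_measurableSet_eq hle hA, trim_measurableSet_eq hle hA,
      Measure.restrict_apply (hle _ hA), hnum σ hσ A hA, Measure.smul_apply,
      withDensity_apply _ (hle _ hA), smul_eq_mul, div_eq_mul_inv, mul_comm]
  rw [← lintegral_trim hle hg, heq, lintegral_trim hle hg, lintegral_smul_measure,
    lintegral_withDensity_eq_lintegral_mul _ hXmT (hg.mono hle le_rfl), smul_eq_mul]
  rfl

lemma NumeraireRel.ae_pos (hs : Setup F T X x₀ Q) (hnum : NumeraireRel F T X x₀ Q Qh) :
    ∀ᵐ ω ∂Qh, 0 < X T ω := by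
  have hT : T ∈ Icc 0 T := ⟨hs.T_pos.le, le_rfl⟩
  have hm : MeasurableSet[F T] {ω | X T ω = 0} := hs.adapted T hT (measurableSet_singleton 0)
  have hA : MemFtau F (fun _ => T) {ω | X T ω = 0} := by
    intro t
    rcases le_or_gt T t with h | h
    · simpa [h] using hs.mono T t h _ hm
    · simp [h.not_ge]
  have h := hnum _ (isStopT_const hT) _ hA
  have h0 : ∫⁻ ω in {ω | X T ω = 0}, valueAt T X (fun _ => T) ω ∂Q = 0 := by
    rw [setLIntegral_congr_fun (g := fun _ => 0) hm
      (fun ω hω => by simpa [valueAt] using hω)]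
    simp
  rw [h0, ENNReal.zero_div] at h
  rw [ae_iff]
  refine measure_mono_null (fun ω hω => ?_) h
  have h1 : X T ω = 0 := by simpa using hω
  exact ⟨h1, by simp [valueAt, h1]⟩

/-! ### Martingales before the hitting time of zero -/

variable {N : ℝ → Ω → ℝ≥0∞}

lemma IsMartBefore.isMart_of_le_hitBelow (hN : IsMartBefore F T Q N (St T X))
    (hs : Setup F T X x₀ Q) (n : ℕ) {σ : Ω → ℝ} (hσ : IsStopT F T σ) (hσT : ∀ ω, σ ω ≤ T)
    (hσn : ∀ ω, σ ω ≤ hitBelow T X (n : ℝ≥0∞)⁻¹ ω) : IsMart F T Q (stopped T N σ) := by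
  refine hN σ hσ ?_
  filter_upwards [hs.ae_init] with ω h0
  have hu : σ ω ∈ Icc 0 T := ⟨hσ.nonneg hs.T_pos ω, hσT ω⟩
  exact hs.lt_St hu (hs.pos_before_hitBelow h0 n hu (hσn ω))

lemma IsMart.lintegral_valueAt (hT : 0 < T) {σ : Ω → ℝ} (hσ : IsStopT F T σ)
    (h : IsMart F T Q (stopped T N σ)) : ∫⁻ ω, valueAt T N σ ω ∂Q = ∫⁻ ω, N 0 ω ∂Q ∧
      ∫⁻ ω, N 0 ω ∂Q ≠ ⊤ := by
  have e1 : stopped T N σ T = valueAt T N σ := by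
    ext ω
    simp [stopped, valueAt]
  have e0 : stopped T N σ 0 = N 0 := by
    ext ω
    simp [stopped, hσ.nonneg hT ω, hT.le]
  have h1 := h.2.2 0 T le_rfl hT.le le_rfl univ MeasurableSet.univ
  have h2 := h.2.1 0 ⟨le_rfl, hT.le⟩
  rw [e1, e0, setLIntegral_univ, setLIntegral_univ] at h1
  rw [e0] at h2
  exact ⟨h1, h2⟩

/-- Optional stopping, on an event off which the two stopping times agree. -/
lemma IsMartBefore.setLIntegral_eq (hN : IsMartBefore F T Q N (St T X))
    (hs : Setup F T X x₀ Q) (n : ℕ) {σ ρ : Ω → ℝ}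
    (hσ : IsStopT F T σ) (hσT : ∀ ω, σ ω ≤ T)
    (hσn : ∀ ω, σ ω ≤ hitBelow T X (n : ℝ≥0∞)⁻¹ ω)
    (hρ : IsStopT F T ρ) (hρT : ∀ ω, ρ ω ≤ T)
    (hρn : ∀ ω, ρ ω ≤ hitBelow T X (n : ℝ≥0∞)⁻¹ ω)
    {D : Set Ω} (hD : MeasurableSet[F T] D) (hDc : ∀ ω ∈ Dᶜ, σ ω = ρ ω) :
    ∫⁻ ω in D, valueAt T N σ ω ∂Q = ∫⁻ ω in D, valueAt T N ρ ω ∂Q := by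
  obtain ⟨h1, hfin⟩ := (hN.isMart_of_le_hitBelow hs n hσ hσT hσn).lintegral_valueAt hs.T_pos hσ
  obtain ⟨h2, -⟩ := (hN.isMart_of_le_hitBelow hs n hρ hρT hρn).lintegral_valueAt hs.T_pos hρ
  have h3 : ∫⁻ ω in Dᶜ, valueAt T N σ ω ∂Q = ∫⁻ ω in Dᶜ, valueAt T N ρ ω ∂Q :=
    setLIntegral_congr_fun hD.compl fun ω hω => by simp [valueAt, hDc ω hω]
  have h4 : ∫⁻ ω in Dᶜ, valueAt T N ρ ω ∂Q ≠ ⊤ :=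
    ne_top_of_le_ne_top (h2 ▸ hfin) (setLIntegral_le_lintegral _ _)
  have h5 := h1.trans h2.symm
  rw [← lintegral_add_compl _ hD, ← lintegral_add_compl (valueAt T N ρ) hD, h3] at h5
  exact (ENNReal.add_left_inj h4).1 h5

/-- The process `N / X` before the explosion time of `X`, set to zero afterwards. -/
def quotProc (T : ℝ) (X N : ℝ → Ω → ℝ≥0∞) : ℝ → Ω → ℝ≥0∞ := fun t =>
  {ω | t < Rt T X ω ∧ 0 < X t ω ∧ X t ω < ⊤}.indicator (fun ω => N t ω / X t ω)

/-- `n / x` where `x` is positive and finite, and zero elsewhere. -/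
def quotFun (p : ℝ≥0∞ × ℝ≥0∞) : ℝ≥0∞ :=
  {p : ℝ≥0∞ × ℝ≥0∞ | 0 < p.1 ∧ p.1 < ⊤}.indicator (fun p => p.2 / p.1) p

lemma measurable_quotFun : Measurable quotFun := by
  refine Measurable.indicator (measurable_snd.div measurable_fst) ?_
  exact (measurableSet_lt measurable_const measurable_fst).inter
    (measurableSet_lt measurable_fst measurable_const)

lemma Setup.quotProc_eq (hs : Setup F T X x₀ Q) {t : ℝ} (ht : t ∈ Icc 0 T) :
    quotProc T X N t ω = quotFun (X t ω, N t ω) := by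
  by_cases h : 0 < X t ω ∧ X t ω < ⊤
  · have h' : t < Rt T X ω ∧ 0 < X t ω ∧ X t ω < ⊤ := ⟨hs.lt_Rt ht h.2, h⟩
    simp [quotProc, quotFun, indicator, h, h']
  · have h' : ¬ (t < Rt T X ω ∧ 0 < X t ω ∧ X t ω < ⊤) := fun h' => h h'.2
    simp only [quotProc, quotFun, indicator, mem_ofPred_eq, if_neg h, if_neg h']

lemma Setup.stopped_quotProc (hs : Setup F T X x₀ Q) {τ : Ω → ℝ} (hτ : IsStopT F T τ) {t : ℝ}
    (ht : t ∈ Icc 0 T) : stopped T (quotProc T X N) τ t = fun ω =>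
      quotFun (valueAt T X (fun ω => min t (τ ω)) ω, valueAt T N (fun ω => min t (τ ω)) ω) := by
  ext ω
  simp only [stopped, valueAt, ← min_assoc]
  exact hs.quotProc_eq ⟨le_min (le_min ht.1 (hτ.nonneg hs.T_pos ω)) hs.T_pos.le, min_le_right _ _⟩

/-- On events prior to a stopping time before `X` reaches zero, integrating `N / X` against `Q̂`
amounts to integrating `N` against `Q`. -/
lemma NumeraireRel.setLIntegral_quotFun (hs : Setup F T X x₀ Q)
    (hnum : NumeraireRel F T X x₀ Q Qh) (hNprog : ProgMeas F T N) (n : ℕ) {σ : Ω → ℝ}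
    (hσ : IsStopT F T σ) (hσT : ∀ ω, σ ω ≤ T)
    (hσn : ∀ ω, σ ω ≤ hitBelow T X (n : ℝ≥0∞)⁻¹ ω) {A : Set Ω} (hA : MemFtau F σ A) :
    ∫⁻ ω in A, quotFun (valueAt T X σ ω, valueAt T N σ ω) ∂Qh =
      x₀⁻¹ * ∫⁻ ω in A, valueAt T N σ ω ∂Q := by
  have hle := stopSigma_le hσ.1 hσT
  have hXm := hs.progMeas.measurable_valueAt hs.T_pos hs.mono hσ hσT
  have hNm := hNprog.measurable_valueAt hs.T_pos hs.mono hσ hσT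
  have hq : Measurable[stopSigma F σ hσ.1]
      fun ω => quotFun (valueAt T X σ ω, valueAt T N σ ω) :=
    measurable_quotFun.comp (hXm.prodMk hNm)
  have hA' : MeasurableSet[stopSigma F σ hσ.1] A := hA
  have hAT : MeasurableSet[F T] A := hle _ hA'
  have hfin : MeasurableSet[F T] {ω | valueAt T X σ ω < ⊤} := hle _ (hXm measurableSet_Iio)
  have h := hnum.lintegral_eq hs hσ hσT (hq.indicator hA')
  rw [← lintegral_indicator hfin] at h
  rw [← lintegral_indicator hAT, ← lintegral_indicator hAT]
  calc _ = _ := lintegral_congr fun ω => ?_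
    _ = _ := h
    _ = _ := ?_
  · by_cases h1 : valueAt T X σ ω < ⊤
    · simp [indicator, h1]
    · simp [indicator, h1, quotFun]
  · congr 1
    refine lintegral_congr_ae ?_
    filter_upwards [hs.ae_init, hs.ae_lt_top] with ω h0 hfinω
    have hu : σ ω ∈ Icc 0 T := ⟨hσ.nonneg hs.T_pos ω, hσT ω⟩
    have hpos := hs.pos_before_hitBelow h0 n hu (hσn ω)
    have hlt := hs.lt_top_of_le hu.1 hu.2 le_rfl hfinω
    by_cases hωA : ω ∈ A
    · simp only [indicator_of_mem hωA, valueAt, min_eq_left hu.2, quotFun]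
      rw [indicator_of_mem (show (X (σ ω) ω, N (σ ω) ω) ∈
        {p : ℝ≥0∞ × ℝ≥0∞ | 0 < p.1 ∧ p.1 < ⊤} from ⟨hpos, hlt⟩)]
      exact ENNReal.mul_div_cancel hpos.ne' hlt.ne
    · simp [indicator_of_notMem hωA]

lemma isMart_stopped_quotProc (hs : Setup F T X x₀ Q)
    (hnum : NumeraireRel F T X x₀ Q Qh) (hNprog : ProgMeas F T N)
    (hN : IsMartBefore F T Q N (St T X)) (n : ℕ) :
    IsMart F T Qh (stopped T (quotProc T X N) (hitBelow T X (n : ℝ≥0∞)⁻¹)) := by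
  set τ := hitBelow T X (n : ℝ≥0∞)⁻¹ with hτdef
  have hτ : IsStopT F T τ := hs.isStopT_hitBelow _
  have hT : T ∈ Icc 0 T := ⟨hs.T_pos.le, le_rfl⟩
  have hu : ∀ t ∈ Icc 0 T, IsStopT F T fun ω => min t (τ ω) := fun t ht =>
    (isStopT_const ht).min hτ
  have huT : ∀ t ∈ Icc 0 T, ∀ ω, min t (τ ω) ≤ T := fun t ht ω => (min_le_left _ _).trans ht.2
  have hun : ∀ t, ∀ ω, min t (τ ω) ≤ τ ω := fun t ω => min_le_right _ _
  have hmart := hN.isMart_of_le_hitBelow hs n (hu T hT) (huT T hT) (hun T)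
  have hst : ∀ t ∈ Icc 0 T, stopped T N (fun ω => min T (τ ω)) t =
      valueAt T N (fun ω => min t (τ ω)) := by
    intro t ht
    ext ω
    simp only [stopped, valueAt]
    congr 1
    rw [min_comm T, min_assoc, min_self, min_assoc]
  refine ⟨fun t ht => ?_, fun t ht => ?_, fun s t h0 hle htT A hA => ?_⟩
  · rw [hs.stopped_quotProc hτ ht]
    have hval : ∀ Y : ℝ → Ω → ℝ≥0∞, ProgMeas F T Y →
        Measurable[F t] (valueAt T Y fun ω => min t (τ ω)) := fun Y hY => by
      convert hY.measurable_min hs.T_pos hs.mono hτ ht using 2 with ω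
      rw [valueAt, min_eq_left (huT t ht ω)]
    exact measurable_quotFun.comp ((hval X hs.progMeas).prodMk (hval N hNprog))
  · rw [hs.stopped_quotProc hτ ht, ← setLIntegral_univ,
      hnum.setLIntegral_quotFun hs hNprog n (hu t ht) (huT t ht) (hun t)
        (fun r => by simpa using (hu t ht).1 r), setLIntegral_univ]
    refine ENNReal.mul_ne_top (ENNReal.inv_ne_top.2 hs.x₀_pos.ne') ?_
    rw [← hst t ht]
    exact hmart.2.1 t ht
  · have ht : t ∈ Icc 0 T := ⟨h0.trans hle, htT⟩
    have hsI : s ∈ Icc 0 T := ⟨h0, hle.trans htT⟩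
    have hBs : MeasurableSet[F s] {ω | τ ω ≤ s} := hτ.1 s
    have hA2s : MeasurableSet[F s] (A \ {ω | τ ω ≤ s}) := hA.diff hBs
    have hA2 : ∀ r ∈ Icc s T, MemFtau F (fun ω => min r (τ ω)) (A \ {ω | τ ω ≤ s}) := by
      intro r hr q
      rcases le_or_gt s q with h | h
      · exact @MeasurableSet.inter _ (F q) _ _ (hs.mono s q h _ hA2s)
          ((hu r ⟨h0.trans hr.1, hr.2⟩).1 q)
      · convert @MeasurableSet.empty Ω (F q)
        ext ω
        simp only [mem_inter_iff, Set.mem_sdiff, mem_ofPred_eq, mem_empty_iff_false, iff_false,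
          not_and, not_le, and_imp]
        exact fun _ h1 => h.trans_le (le_min hr.1 h1.le)
    have hsT := hs.mono s T hsI.2
    rw [← lintegral_inter_add_sdiff (stopped T (quotProc T X N) τ t) A (hsT _ hBs),
      ← lintegral_inter_add_sdiff (stopped T (quotProc T X N) τ s) A (hsT _ hBs)]
    congr 1
    · refine setLIntegral_congr_fun ((hsT _ hA).inter (hsT _ hBs)) fun ω hω => ?_
      have h1 : τ ω ≤ s := hω.2
      simp only [stopped]
      congr 1
      rw [min_eq_right ((min_le_left _ _).trans (h1.trans hle)),
        min_eq_right ((min_le_left _ _).trans h1)]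
    · rw [hs.stopped_quotProc hτ ht, hs.stopped_quotProc hτ hsI,
        hnum.setLIntegral_quotFun hs hNprog n (hu t ht) (huT t ht) (hun t) (hA2 t ⟨hle, htT⟩),
        hnum.setLIntegral_quotFun hs hNprog n (hu s hsI) (huT s hsI) (hun s)
          (hA2 s ⟨le_rfl, hsI.2⟩), ← hst t ht, ← hst s hsI,
        hmart.2.2 s t h0 hle htT _ hA2s]

/-! ### The limit at the explosion time -/

/-- The set of pairs `(x, y)` with `x ≥ i` and `y ≥ x / k`. -/
def largeRatio (k i : ℕ) : Set (ℝ≥0∞ × ℝ≥0∞) := {p | (i : ℝ≥0∞) ≤ p.1 ∧ p.1 ≤ k * p.2}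

lemma isClosed_largeRatio (k i : ℕ) : IsClosed (largeRatio k i) :=
  (isClosed_le continuous_const continuous_fst).inter
    (isClosed_le continuous_fst
      ((ENNReal.continuous_const_mul (ENNReal.natCast_ne_top k)).comp continuous_snd))

lemma measure_largeRatio_eq_zero (hs : Setup F T X x₀ Q)
    (hnum : NumeraireRel F T X x₀ Q Qh) (hNprog : ProgMeas F T N)
    (hNcont : ∀ ω, ContinuousOn (fun t => N t ω) (Icc 0 T))
    (hN : IsMartBefore F T Q N (St T X)) (n k : ℕ) :
    Qh {ω | hitBelow T X (n : ℝ≥0∞)⁻¹ ω = T + 1 ∧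
      ∀ i : ℕ, ∃ t ∈ Icc 0 T, (X t ω, N t ω) ∈ largeRatio k i ∧ X t ω < ⊤} = 0 := by
  set E := {ω | hitBelow T X (n : ℝ≥0∞)⁻¹ ω = T + 1 ∧
      ∀ i : ℕ, ∃ t ∈ Icc 0 T, (X t ω, N t ω) ∈ largeRatio k i ∧ X t ω < ⊤} with hE
  have hT : T ∈ Icc 0 T := ⟨hs.T_pos.le, le_rfl⟩
  set Z : ℝ → Ω → ℝ≥0∞ × ℝ≥0∞ := fun t ω => (X t ω, N t ω) with hZ
  have hZc : ∀ ω, ContinuousOn (fun t => Z t ω) (Icc 0 T) := fun ω =>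
    (hs.contPaths ω).prodMk (hNcont ω)
  set ρ : ℕ → Ω → ℝ := fun i => hitSet T Z (largeRatio k i) with hρdef
  have hρ : ∀ i, IsStopT F T (ρ i) := fun i =>
    isStopT_hitSet hs.T_pos hs.mono
      (fun t ht => (hs.adapted t ht).prodMk (hNprog.adapted hs.T_pos hs.mono ht)) hZc
      (isClosed_largeRatio k i)
  set σ : Ω → ℝ := fun ω => min (hitBelow T X (n : ℝ≥0∞)⁻¹ ω) T with hσdef
  have hσ : IsStopT F T σ := (hs.isStopT_hitBelow _).min (isStopT_const hT)
  have hτ : ∀ i, IsStopT F T fun ω => min (ρ i ω) (σ ω) := fun i => (hρ i).min hσ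
  have hσT : ∀ ω, σ ω ≤ T := fun ω => min_le_right _ _
  have hσn : ∀ ω, σ ω ≤ hitBelow T X (n : ℝ≥0∞)⁻¹ ω := fun ω => min_le_left _ _
  have hτT : ∀ i ω, min (ρ i ω) (σ ω) ≤ T := fun i ω => (min_le_right _ _).trans (hσT ω)
  have hτn : ∀ i ω, min (ρ i ω) (σ ω) ≤ hitBelow T X (n : ℝ≥0∞)⁻¹ ω := fun i ω =>
    (min_le_right _ _).trans (hσn ω)
  have hD : ∀ i, MeasurableSet[F T] {ω | ρ i ω ≤ T} := fun i => (hρ i).1 T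
  have bound : ∀ i, Qh E ≤
      x₀⁻¹ * (k * ∫⁻ ω, {ω | ρ i ω ≤ T}.indicator (valueAt T N σ) ω ∂Q) := by
    intro i
    set τ : Ω → ℝ := fun ω => min (ρ i ω) (σ ω) with hτdef
    set A : Set Ω := {ω | (valueAt T X τ ω, valueAt T N τ ω) ∈ largeRatio k i} with hAdef
    have hA : MemFtau F τ A :=
      ((hs.progMeas.measurable_valueAt hs.T_pos hs.mono (hτ i) (hτT i)).prodMk
        (hNprog.measurable_valueAt hs.T_pos hs.mono (hτ i) (hτT i)))
        (isClosed_largeRatio k i).measurableSet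
    have hAT : MeasurableSet[F T] A := stopSigma_le (hτ i).1 (hτT i) _ hA
    have hEA : E ⊆ A ∩ {ω | valueAt T X τ ω < ⊤} := by
      rintro ω ⟨h1, h2⟩
      obtain ⟨t, ht, htC, htop⟩ := h2 i
      have hρt : ρ i ω ≤ t := hitSet_le (Z := Z) hs.T_pos ht htC
      have hρI : ρ i ω ∈ Icc 0 T := ⟨(hρ i).nonneg hs.T_pos ω, hρt.trans ht.2⟩
      have hτω : min (τ ω) T = ρ i ω := by
        have : σ ω = T := by simp [hσdef, h1]
        simp [hτdef, this, hρI.2]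
      have hmem : Z (ρ i ω) ω ∈ largeRatio k i := by
        rcases hitSet_spec hs.T_pos (hZc ω) (isClosed_largeRatio k i) with h | h
        · exact h.2
        · exact absurd (h.symm.le.trans hρI.2) (by linarith)
      simp only [hAdef, mem_inter_iff, mem_ofPred_eq, valueAt, hτω]
      exact ⟨hmem, hs.lt_top_of_le hρI.1 hρt ht.2 htop⟩
    have hAD : A ⊆ {ω | ρ i ω ≤ T} := by
      intro ω hω
      have hI : min (τ ω) T ∈ Icc 0 T :=
        ⟨le_min ((hτ i).nonneg hs.T_pos ω) hs.T_pos.le, min_le_right _ _⟩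
      exact (hitSet_le (Z := Z) hs.T_pos hI hω).trans hI.2
    have hNτ : Measurable[F T] (valueAt T N τ) :=
      (hNprog.measurable_valueAt hs.T_pos hs.mono (hτ i) (hτT i)).mono
        (stopSigma_le (hτ i).1 (hτT i)) le_rfl
    calc Qh E ≤ Qh (A ∩ {ω | valueAt T X τ ω < ⊤}) := measure_mono hEA
      _ = x₀⁻¹ * ∫⁻ ω in A, valueAt T X τ ω ∂Q := by
        rw [hnum τ (hτ i) A hA, div_eq_mul_inv, mul_comm]
      _ ≤ x₀⁻¹ * ∫⁻ ω in A, k * valueAt T N τ ω ∂Q := by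
        gcongr 1
        exact setLIntegral_mono' hAT fun ω hω => hω.2
      _ = x₀⁻¹ * (k * ∫⁻ ω in A, valueAt T N τ ω ∂Q) := by
        rw [lintegral_const_mul _ hNτ]
      _ ≤ x₀⁻¹ * (k * ∫⁻ ω in {ω | ρ i ω ≤ T}, valueAt T N τ ω ∂Q) := by
        gcongr 2
        exact lintegral_mono_set hAD
      _ = x₀⁻¹ * (k * ∫⁻ ω in {ω | ρ i ω ≤ T}, valueAt T N σ ω ∂Q) := by
        rw [hN.setLIntegral_eq hs n (hτ i) (hτT i) (hτn i) hσ hσT hσn (hD i)]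
        intro ω hω
        have hω' : T < ρ i ω := not_le.1 hω
        exact min_eq_right ((hσT ω).trans hω'.le)
      _ = _ := by rw [lintegral_indicator (hD i)]
  have hlim : Tendsto (fun i => ∫⁻ ω, {ω | ρ i ω ≤ T}.indicator (valueAt T N σ) ω ∂Q) atTop
      (𝓝 (∫⁻ _, 0 ∂Q)) := by
    have hNσ : Measurable[F T] (valueAt T N σ) :=
      (hNprog.measurable_valueAt hs.T_pos hs.mono hσ hσT).mono
        (stopSigma_le hσ.1 hσT) le_rfl
    obtain ⟨h1, h2⟩ := (hN.isMart_of_le_hitBelow hs n hσ hσT hσn).lintegral_valueAt hs.T_pos hσ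
    let _ := F T
    refine tendsto_lintegral_of_dominated_convergence (valueAt T N σ)
      (fun i => hNσ.indicator (hD i))
      (fun i => ae_of_all _ fun ω => indicator_le_self _ _ ω) (h1 ▸ h2) ?_
    filter_upwards [hs.ae_lt_top] with ω hω
    obtain ⟨m, hm⟩ := hs.exists_nat_gt hT hω
    refine tendsto_const_nhds.congr' ?_
    filter_upwards [eventually_ge_atTop m] with i hi
    rw [indicator_of_notMem]
    intro hc
    obtain ⟨s, hsI, hsC⟩ :=
      (hitSet_le_iff hs.T_pos (hZc ω) (isClosed_largeRatio k i) le_rfl).1 hc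
    have h3 : (i : ℝ≥0∞) ≤ X s ω := hsC.1
    have h4 : (m : ℝ≥0∞) ≤ i := by exact_mod_cast hi
    exact absurd (hm s hsI) (h4.trans h3).not_gt
  rw [lintegral_zero] at hlim
  have hlim' := ENNReal.Tendsto.const_mul (a := x₀⁻¹)
    (ENNReal.Tendsto.const_mul (a := (k : ℝ≥0∞)) hlim (Or.inr (ENNReal.natCast_ne_top k)))
    (Or.inr (ENNReal.inv_ne_top.2 hs.x₀_pos.ne'))
  rw [mul_zero, mul_zero] at hlim'
  exact le_antisymm (ge_of_tendsto' hlim' bound) zero_le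

lemma Setup.exists_largeRatio (hs : Setup F T X x₀ Q) (hR : Rt T X ω ≤ T) {k : ℕ} (hk : k ≠ 0)
    (h : ∃ᶠ t in 𝓝[Iio (Rt T X ω) ∩ Icc 0 T] (Rt T X ω), (k : ℝ≥0∞)⁻¹ ≤ N t ω / X t ω) (i : ℕ) :
    ∃ t ∈ Icc 0 T, (X t ω, N t ω) ∈ largeRatio k i ∧ X t ω < ⊤ := by
  have hRI : Rt T X ω ∈ Icc 0 T := ⟨hs.Rt_nonneg, hR⟩
  have hXR : X (Rt T X ω) ω = ⊤ := by
    by_contra hc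
    exact lt_irrefl _ (hs.lt_Rt hRI (lt_top_iff_ne_top.2 hc))
  have hev : ∀ᶠ t in 𝓝[Iio (Rt T X ω) ∩ Icc 0 T] (Rt T X ω), (i : ℝ≥0∞) < X t ω :=
    (((hs.contPaths ω) _ hRI).mono inter_subset_right).eventually_const_lt
      (by simp [hXR])
  obtain ⟨t, hkt, hit, htR, htI⟩ := (h.and_eventually (hev.and self_mem_nhdsWithin)).exists
  have htop : X t ω < ⊤ := by
    by_contra hc
    exact (hs.Rt_le htI (not_lt_top_iff.1 hc)).not_gt htR
  refine ⟨t, htI, ⟨hit.le, ?_⟩, htop⟩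
  rw [ENNReal.le_div_iff_mul_le (Or.inl (ne_bot_of_gt hit)) (Or.inl htop.ne), mul_comm] at hkt
  exact (ENNReal.inv_mul_le_iff (Nat.cast_ne_zero.2 hk) (ENNReal.natCast_ne_top k)).1
    (mul_comm (X t ω) _ ▸ hkt)

end Paths

end Helpers

/-- Equivalence of (local) martingales, part (iii).  For a nonnegative
progressively measurable `N` with continuous paths: if `N` is a `Q`-martingale on
`[0,S)`, then `M_t := (N_t/X_t)·1_{t<R}·1_{0<X_t<∞}` is a `Q̂`-local martingale on
`[0,T]`, and `Q̂`-a.s. on `{R ≤ T}` the left limit of `N/X` at `R` equals `0`. -/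
theorem statement8 {Ω : Type*} (F : ℝ → MeasurableSpace Ω) (T : ℝ)
    (X : ℝ → Ω → ℝ≥0∞) (x₀ : ℝ≥0∞) (Q Qh : @Measure Ω (F T))
    (hsetup : Setup F T X x₀ Q) (hQh : IsProbabilityMeasure Qh)
    (hnum : NumeraireRel F T X x₀ Q Qh)
    (N : ℝ → Ω → ℝ≥0∞) (hNprog : ProgMeas F T N)
    (hNcont : ∀ ω, ContinuousOn (fun t => N t ω) (Icc 0 T))
    (hN : IsMartBefore F T Q N (St T X)) :
    IsLocMart F T Qh
      (fun t => {ω | t < Rt T X ω ∧ 0 < X t ω ∧ X t ω < ⊤}.indicator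
        (fun ω => N t ω / X t ω)) ∧
    ∀ᵐ ω ∂Qh, Rt T X ω ≤ T →
      Tendsto (fun t => N t ω / X t ω)
        (𝓝[Iio (Rt T X ω) ∩ Icc 0 T] (Rt T X ω)) (𝓝 0) := by
  have ht : T ∈ Icc 0 T := ⟨hsetup.T_pos.le, le_rfl⟩
  have hev : ∀ᵐ ω ∂Qh, ∃ m : ℕ, ∀ n ≥ m, hitBelow T X (n : ℝ≥0∞)⁻¹ ω = T + 1 := by
    filter_upwards [hnum.ae_pos hsetup] with ω hω
    obtain ⟨m, hm⟩ := hsetup.exists_inv_nat_lt ht hω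
    refine ⟨m, fun n hn => ?_⟩
    have h1 : T < hitBelow T X (n : ℝ≥0∞)⁻¹ ω := hsetup.lt_hitBelow ht fun s hs =>
      (ENNReal.inv_le_inv.2 (by exact_mod_cast hn)).trans_lt (hm s hs)
    rcases (hsetup.isStopT_hitBelow (n : ℝ≥0∞)⁻¹).2 ω with h | h
    · exact absurd h.2 h1.not_ge
    · exact h
  refine ⟨⟨fun n => hitBelow T X (n : ℝ≥0∞)⁻¹, fun n => hsetup.isStopT_hitBelow _,
    fun n ω => ?_, ?_, fun n => isMart_stopped_quotProc hsetup hnum hNprog hN n⟩, ?_⟩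
  · refine csInf_le_csInf (bddBelow_hitSet (Z := X) (C := Iic (n : ℝ≥0∞)⁻¹) hsetup.T_pos)
      ⟨T + 1, Or.inr rfl⟩ (union_subset_union_left _ fun t h => ⟨h.1, h.2.trans ?_⟩)
    exact ENNReal.inv_le_inv.2 (by exact_mod_cast n.le_succ)
  · rw [← measure_univ (μ := Qh)]
    refine measure_congr (eventuallyEq_univ.2 ?_)
    filter_upwards [hev] with ω hω
    exact eventually_atTop.2 hω
  · have hnull : ∀ᵐ ω ∂Qh, ∀ n k : ℕ, ¬ (hitBelow T X (n : ℝ≥0∞)⁻¹ ω = T + 1 ∧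
        ∀ i : ℕ, ∃ t ∈ Icc 0 T, (X t ω, N t ω) ∈ largeRatio k i ∧ X t ω < ⊤) := by
      refine ae_all_iff.2 fun n => ae_all_iff.2 fun k => ?_
      rw [ae_iff]
      simpa only [not_not] using measure_largeRatio_eq_zero hsetup hnum hNprog hNcont hN n k
    filter_upwards [hev, hnull] with ω ⟨m, hm⟩ hω hR
    rw [ENNReal.tendsto_nhds_zero]
    intro ε hε
    obtain ⟨k, hk⟩ := ENNReal.exists_inv_nat_lt hε.ne'
    by_contra hc
    refine hω m k ⟨hm m le_rfl, fun i => hsetup.exists_largeRatio hR ?_ ?_ i⟩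
    · rintro rfl
      simp at hk
    · exact (not_eventually.1 hc).mono fun t h => hk.le.trans (not_le.1 h).le

end Paper
end
end

section
/- International put–call equivalence: for every K > 0, p^$(D^{C,$}_K) = x_0·K·p^€(D^{P,€}_{1/K}) and p^$(D^{P,$}_K) = x_0·K·p^€(D^{C,€}_{1/K}). -/
open MeasureTheory Filter Set Topology
open scoped ENNReal NNReal

noncomputable section

namespace Paper

/-- `(Dd, De)` is a contingent claim: both payoffs are `F_T`-measurable with values in
`[0,∞]`, and `D^€ = D^$/X_T` on `{0 < X_T < ∞}`. -/
def IsClaim {Ω : Type*} (F : ℝ → MeasurableSpace Ω) (T : ℝ) (X : ℝ → Ω → ℝ≥0∞)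
    (Dd De : Ω → ℝ≥0∞) : Prop :=
  Measurable[F T] Dd ∧ Measurable[F T] De ∧
    ∀ ω, 0 < X T ω → X T ω < ⊤ → De ω = Dd ω / X T ω

/-- the Dollar price of a contingent claim:
`p^$((D^$,D^€)) := E^Q[D^$] + x₀·E^{Q̂}[D^€·1_{X_T = ∞}]`. -/
def priceD {Ω : Type*} (F : ℝ → MeasurableSpace Ω) (T : ℝ) (X : ℝ → Ω → ℝ≥0∞)
    (x₀ : ℝ≥0∞) (Q Qh : @Measure Ω (F T)) (Dd De : Ω → ℝ≥0∞) : ℝ≥0∞ :=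
  ∫⁻ ω, Dd ω ∂Q + x₀ * ∫⁻ ω in {ω | X T ω = ⊤}, De ω ∂Qh

/-- the Euro price of a contingent claim:
`p^€((D^$,D^€)) := E^{Q̂}[D^€] + (1/x₀)·E^Q[D^$·1_{X_T = 0}]`. -/
def priceE {Ω : Type*} (F : ℝ → MeasurableSpace Ω) (T : ℝ) (X : ℝ → Ω → ℝ≥0∞)
    (x₀ : ℝ≥0∞) (Q Qh : @Measure Ω (F T)) (Dd De : Ω → ℝ≥0∞) : ℝ≥0∞ :=
  ∫⁻ ω, De ω ∂Qh + (∫⁻ ω in {ω | X T ω = 0}, Dd ω ∂Q) / x₀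

/-- Dollar payoff of the call on one Euro with strike `K ∈ ℝ`: `(X_T − K)^+ ∈ [0,∞]`. -/
def callD {Ω : Type*} (T : ℝ) (X : ℝ → Ω → ℝ≥0∞) (K : ℝ) : Ω → ℝ≥0∞ :=
  fun ω => if X T ω = ⊤ then ⊤ else ENNReal.ofReal ((X T ω).toReal - K)

/-- Euro payoff of the call on one Euro with strike `K ∈ ℝ`: `(1 − K/X_T)^+`, with the
conventions `K/0 := +∞` if `K > 0`, `K/0 := −∞` if `K < 0`, `0/0 := 0`, `K/∞ := 0`. -/
def callE {Ω : Type*} (T : ℝ) (X : ℝ → Ω → ℝ≥0∞) (K : ℝ) : Ω → ℝ≥0∞ :=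
  fun ω =>
    if X T ω = ⊤ then 1
    else if X T ω = 0 then (if 0 < K then 0 else if K < 0 then ⊤ else 1)
    else ENNReal.ofReal (1 - K / (X T ω).toReal)

/-- Dollar payoff of the put on one Euro with strike `K ∈ ℝ`: `(K − X_T)^+`. -/
def putD {Ω : Type*} (T : ℝ) (X : ℝ → Ω → ℝ≥0∞) (K : ℝ) : Ω → ℝ≥0∞ :=
  fun ω => if X T ω = ⊤ then 0 else ENNReal.ofReal (K - (X T ω).toReal)

/-- Euro payoff of the put on one Euro with strike `K ∈ ℝ`: `(K/X_T − 1)^+` (same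
division conventions as for the call). -/
def putE {Ω : Type*} (T : ℝ) (X : ℝ → Ω → ℝ≥0∞) (K : ℝ) : Ω → ℝ≥0∞ :=
  fun ω =>
    if X T ω = ⊤ then 0
    else if X T ω = 0 then (if 0 < K then ⊤ else 0)
    else ENNReal.ofReal (K / (X T ω).toReal - 1)

/-- the canonical embedding `[0,∞] → [−∞,∞]`. -/
def toE (x : ℝ≥0∞) : EReal := if x = ⊤ then ⊤ else ((x.toReal : ℝ) : EReal)

/-- Dollar payoff of the call on one Dollar with strike `K' ∈ ℝ`: `(1 − K'·X_T)^+`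
(with the convention `∞·0 := 0`). -/
def callDualD {Ω : Type*} (T : ℝ) (X : ℝ → Ω → ℝ≥0∞) (K' : ℝ) : Ω → ℝ≥0∞ :=
  fun ω =>
    if X T ω = ⊤ then (if 0 < K' then 0 else if K' < 0 then ⊤ else 1)
    else ENNReal.ofReal (1 - K' * (X T ω).toReal)

/-- Euro payoff of the call on one Dollar with strike `K' ∈ ℝ`: `(1/X_T − K')^+`
(with `1/0 := ∞`, `1/∞ := 0`). -/
def callDualE {Ω : Type*} (T : ℝ) (X : ℝ → Ω → ℝ≥0∞) (K' : ℝ) : Ω → ℝ≥0∞ :=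
  fun ω =>
    if X T ω = 0 then ⊤
    else ENNReal.ofReal (1 / (X T ω).toReal - K')

/-- Dollar payoff of the put on one Dollar with strike `K' ∈ ℝ`: `(K'·X_T − 1)^+`. -/
def putDualD {Ω : Type*} (T : ℝ) (X : ℝ → Ω → ℝ≥0∞) (K' : ℝ) : Ω → ℝ≥0∞ :=
  fun ω =>
    if X T ω = ⊤ then (if 0 < K' then ⊤ else 0)
    else ENNReal.ofReal (K' * (X T ω).toReal - 1)

/-- Euro payoff of the put on one Dollar with strike `K' ∈ ℝ`: `(K' − 1/X_T)^+`. -/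
def putDualE {Ω : Type*} (T : ℝ) (X : ℝ → Ω → ℝ≥0∞) (K' : ℝ) : Ω → ℝ≥0∞ :=
  fun ω =>
    if X T ω = 0 then 0
    else ENNReal.ofReal (K' - 1 / (X T ω).toReal)

/-- The numéraire relation at the deterministic time `T`. -/
theorem NumeraireRel.at_T {Ω : Type*} {F : ℝ → MeasurableSpace Ω} {T : ℝ}
    {X : ℝ → Ω → ℝ≥0∞} {x₀ : ℝ≥0∞} {Q Qh : @Measure Ω (F T)} (hsetup : Setup F T X x₀ Q)
    (hnum : NumeraireRel F T X x₀ Q Qh) {A : Set Ω} (hA : MeasurableSet[F T] A) :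
    Qh (A ∩ {ω | X T ω < ⊤}) = (∫⁻ ω in A, X T ω ∂Q) / x₀ := by
  have hτ : IsStopT F T (fun _ => T) :=
    ⟨fun t => MeasurableSet.const _, fun _ => Or.inl ⟨hsetup.T_pos.le, le_rfl⟩⟩
  have hAτ : MemFtau F (fun _ => T) A := by
    intro t
    by_cases ht : T ≤ t
    · simpa [ht] using hsetup.mono T t ht A hA
    · simp [ht]
  simpa [valueAt] using hnum _ hτ A hAτ

section ChangeOfMeasure

variable {Ω : Type*} [MeasurableSpace Ω] {Q Qh : Measure Ω} {Y : Ω → ℝ≥0∞} {x₀ : ℝ≥0∞}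

theorem measure_eq_top_of_numeraire (hY : Measurable Y) (hx : x₀ ≠ ⊤)
    (h : ∀ A, MeasurableSet A → Qh (A ∩ {ω | Y ω < ⊤}) = (∫⁻ ω in A, Y ω ∂Q) / x₀) :
    Q {ω | Y ω = ⊤} = 0 := by
  have hm : MeasurableSet {ω | Y ω = ⊤} := hY (measurableSet_singleton ⊤)
  have he : {ω | Y ω = ⊤} ∩ {ω | Y ω < ⊤} = ∅ := by
    ext ω; simp +contextual
  have h1 := h _ hm
  rw [he, measure_empty, setLIntegral_congr_fun (g := fun _ => ⊤) hm (fun ω hω => hω),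
    setLIntegral_const, eq_comm, ENNReal.div_eq_zero_iff] at h1
  simpa [hx] using h1

/-- Change of numéraire for nonnegative payoffs. -/
theorem lintegral_numeraire (hY : Measurable Y) (hx0 : x₀ ≠ 0) (hx : x₀ ≠ ⊤)
    (h : ∀ A, MeasurableSet A → Qh (A ∩ {ω | Y ω < ⊤}) = (∫⁻ ω in A, Y ω ∂Q) / x₀)
    {g : Ω → ℝ≥0∞} (hg : Measurable g) :
    x₀ * ∫⁻ ω, g ω ∂Qh = ∫⁻ ω, Y ω * g ω ∂Q + x₀ * ∫⁻ ω in {ω | Y ω = ⊤}, g ω ∂Qh := by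
  have hm : MeasurableSet {ω | Y ω = ⊤} := hY (measurableSet_singleton ⊤)
  have hc : {ω | Y ω = ⊤}ᶜ = {ω | Y ω < ⊤} := by
    ext ω; simp [lt_top_iff_ne_top]
  have hμ : x₀ • Qh.restrict {ω | Y ω < ⊤} = Q.withDensity Y := by
    ext A hA
    rw [Measure.smul_apply, Measure.restrict_apply hA, h A hA, withDensity_apply _ hA,
      smul_eq_mul, ENNReal.mul_div_cancel hx0 hx]
  have h1 : ∫⁻ ω, Y ω * g ω ∂Q = x₀ * ∫⁻ ω in {ω | Y ω < ⊤}, g ω ∂Qh := by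
    have h2 := lintegral_withDensity_eq_lintegral_mul Q hY hg
    rw [← hμ, lintegral_smul_measure, smul_eq_mul] at h2
    exact h2.symm
  rw [h1, ← lintegral_add_compl g hm, hc, mul_add, add_comm]

end ChangeOfMeasure

/-- `K · y · (1/K - 1/y)⁺ = (y - K)⁺` for finite `y`. -/
theorem ofReal_mul_mul_put {K : ℝ} (hK : 0 < K) {y : ℝ≥0∞} (hy : y ≠ ⊤) :
    ENNReal.ofReal K * (y * if y = 0 then 0 else ENNReal.ofReal (1 / K - 1 / y.toReal))
      = ENNReal.ofReal (y.toReal - K) := by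
  by_cases h0 : y = 0
  · simp [h0, hK.le]
  · have hpos : 0 < y.toReal := ENNReal.toReal_pos h0 hy
    rw [if_neg h0, ← ENNReal.ofReal_toReal hy, ENNReal.toReal_ofReal hpos.le,
      ← ENNReal.ofReal_mul hpos.le, ← ENNReal.ofReal_mul hK.le]
    congr 1
    field_simp

/-- `K · y · (1/y - 1/K)⁺ + K · 1_{y = 0} = (K - y)⁺` for finite `y`, with `0 · ∞ = 0`. -/
theorem ofReal_mul_mul_call {K : ℝ} (hK : 0 < K) {y : ℝ≥0∞} (hy : y ≠ ⊤) :
    ENNReal.ofReal K * (y * if y = 0 then ⊤ else ENNReal.ofReal (1 / y.toReal - 1 / K))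
      + ENNReal.ofReal K * (if y = 0 then 1 else 0) = ENNReal.ofReal (K - y.toReal) := by
  by_cases h0 : y = 0
  · simp [h0]
  · have hpos : 0 < y.toReal := ENNReal.toReal_pos h0 hy
    rw [if_neg h0, if_neg h0, mul_zero, add_zero, ← ENNReal.ofReal_toReal hy,
      ENNReal.toReal_ofReal hpos.le, ← ENNReal.ofReal_mul hpos.le, ← ENNReal.ofReal_mul hK.le]
    congr 1
    field_simp

/-- International put–call equivalence.  For every `K > 0`:
`p^$(D^{C,$}_K) = x₀·K·p^€(D^{P,€}_{1/K})` and `p^$(D^{P,$}_K) = x₀·K·p^€(D^{C,€}_{1/K})`. -/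
theorem statement17 {Ω : Type*} (F : ℝ → MeasurableSpace Ω) (T : ℝ)
    (X : ℝ → Ω → ℝ≥0∞) (x₀ : ℝ≥0∞) (Q Qh : @Measure Ω (F T))
    (hsetup : Setup F T X x₀ Q) (hQh : IsProbabilityMeasure Qh)
    (hnum : NumeraireRel F T X x₀ Q Qh) (K : ℝ) (hK : 0 < K) :
    priceD F T X x₀ Q Qh (callD T X K) (callE T X K)
      = x₀ * ENNReal.ofReal K * priceE F T X x₀ Q Qh (putDualD T X (1/K)) (putDualE T X (1/K)) ∧
    priceD F T X x₀ Q Qh (putD T X K) (putE T X K)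
      = x₀ * ENNReal.ofReal K * priceE F T X x₀ Q Qh (callDualD T X (1/K)) (callDualE T X (1/K)) := by
  have hx0 : x₀ ≠ 0 := hsetup.x₀_pos.ne'
  have hx : x₀ ≠ ⊤ := hsetup.x₀_lt_top.ne
  have hKx : ENNReal.ofReal K * ENNReal.ofReal (1 / K) = 1 := by
    rw [← ENNReal.ofReal_mul hK.le, mul_one_div_cancel hK.ne', ENNReal.ofReal_one]
  let _ : MeasurableSpace Ω := F T
  have hY : Measurable (X T) := hsetup.adapted T ⟨hsetup.T_pos.le, le_rfl⟩
  have hm0 : MeasurableSet {ω | X T ω = 0} := hY (measurableSet_singleton 0)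
  have hmtop : MeasurableSet {ω | X T ω = ⊤} := hY (measurableSet_singleton ⊤)
  have hrel : ∀ A, MeasurableSet A →
      Qh (A ∩ {ω | X T ω < ⊤}) = (∫⁻ ω in A, X T ω ∂Q) / x₀ :=
    fun A hA => hnum.at_T hsetup hA
  have hfin : ∀ᵐ ω ∂Q, X T ω ≠ ⊤ := by
    simpa [ae_iff] using measure_eq_top_of_numeraire hY hx hrel
  have hmP : Measurable (putDualE T X (1 / K)) :=
    Measurable.ite hm0 measurable_const
      ((measurable_const.sub (hY.ennreal_toReal.const_div 1)).ennreal_ofReal)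
  have hmC : Measurable (callDualE T X (1 / K)) :=
    Measurable.ite hm0 measurable_const
      (((hY.ennreal_toReal.const_div 1).sub measurable_const).ennreal_ofReal)
  constructor
  · have hD : ∫⁻ ω in {ω | X T ω = 0}, putDualD T X (1 / K) ω ∂Q = 0 := by
      rw [setLIntegral_congr_fun (g := fun _ => 0) hm0, lintegral_zero]
      intro ω hω
      have hω' : X T ω = 0 := hω
      simp [putDualD, hω']
    have hE : ∫⁻ ω in {ω | X T ω = ⊤}, callE T X K ω ∂Qh = Qh {ω | X T ω = ⊤} := by
      rw [setLIntegral_congr_fun (g := fun _ => 1) hmtop, setLIntegral_one]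
      intro ω hω
      exact if_pos hω
    have hE' : ∫⁻ ω in {ω | X T ω = ⊤}, putDualE T X (1 / K) ω ∂Qh
        = ENNReal.ofReal (1 / K) * Qh {ω | X T ω = ⊤} := by
      rw [setLIntegral_congr_fun (g := fun _ => ENNReal.ofReal (1 / K)) hmtop, setLIntegral_const]
      intro ω hω
      have hω' : X T ω = ⊤ := hω
      simp [putDualE, hω']
    have hQ : ∫⁻ ω, callD T X K ω ∂Q
        = ENNReal.ofReal K * ∫⁻ ω, X T ω * putDualE T X (1 / K) ω ∂Q := by
      rw [← lintegral_const_mul' _ _ ENNReal.ofReal_ne_top]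
      refine lintegral_congr_ae ?_
      filter_upwards [hfin] with ω hω
      simpa [callD, hω, putDualE] using (ofReal_mul_mul_put hK hω).symm
    rw [priceD, priceE, hD, ENNReal.zero_div, add_zero, hE, hQ, mul_comm x₀ (ENNReal.ofReal K), mul_assoc,
      lintegral_numeraire hY hx0 hx hrel hmP, hE', mul_add, mul_left_comm x₀,
      ← mul_assoc (ENNReal.ofReal K), hKx, one_mul]
  · have hD : ∫⁻ ω in {ω | X T ω = 0}, callDualD T X (1 / K) ω ∂Q
        = ∫⁻ ω, (if X T ω = 0 then 1 else 0) ∂Q := by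
      rw [← lintegral_indicator hm0]
      refine lintegral_congr fun ω => ?_
      by_cases h : X T ω = 0 <;> simp [callDualD, h]
    have hE : ∫⁻ ω in {ω | X T ω = ⊤}, putE T X K ω ∂Qh = 0 := by
      rw [setLIntegral_congr_fun (g := fun _ => 0) hmtop, lintegral_zero]
      intro ω hω
      exact if_pos hω
    have hE' : ∫⁻ ω in {ω | X T ω = ⊤}, callDualE T X (1 / K) ω ∂Qh = 0 := by
      rw [setLIntegral_congr_fun (g := fun _ => 0) hmtop, lintegral_zero]
      intro ω hω
      have hω' : X T ω = ⊤ := hω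
      simp [callDualE, hω', hK.le]
    have hmI : Measurable fun ω => if X T ω = 0 then (1 : ℝ≥0∞) else 0 :=
      Measurable.ite hm0 measurable_const measurable_const
    have hQ : ∫⁻ ω, putD T X K ω ∂Q
        = ENNReal.ofReal K * (∫⁻ ω, X T ω * callDualE T X (1 / K) ω ∂Q
          + ∫⁻ ω, (if X T ω = 0 then 1 else 0) ∂Q) := by
      rw [← lintegral_add_right _ hmI, ← lintegral_const_mul' _ _ ENNReal.ofReal_ne_top]
      refine lintegral_congr_ae ?_
      filter_upwards [hfin] with ω hω
      rw [mul_add]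
      simpa [putD, hω, callDualE] using (ofReal_mul_mul_call hK hω).symm
    rw [priceD, priceE, hD, hE, hQ, mul_zero, add_zero, mul_comm x₀ (ENNReal.ofReal K), mul_assoc, mul_add x₀,
      lintegral_numeraire hY hx0 hx hrel hmC, hE', mul_zero, add_zero,
      ENNReal.mul_div_cancel hx0 hx]

end Paper
end
end

section
/- (a) If Q(S = T+1) = 1 (i.e., X does not hit zero Q-almost surely), then p^€((D^$, D^€)) = E^{Q̂}[D^€] for every contingent claim (D^$, D^€). (b) If X is a true Q-martingale (equivalently, Q̂(R = T+1) = 1), then p^$((D^$, D^€)) = E^Q[D^$] for every contingent claim (D^$, D^€). -/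
open MeasureTheory Filter Set Topology
open scoped ENNReal NNReal

noncomputable section

namespace Paper

/-- A path that ends at `0` hits every level `1/i` by time `T`, so `S ≤ T`. -/
lemma St_le_of_eq_zero {Ω : Type*} {T : ℝ} (hT : 0 ≤ T) {X : ℝ → Ω → ℝ≥0∞} {ω : Ω}
    (hω : X T ω = 0) : St T X ω ≤ T := by
  refine ciSup_le fun i => csInf_le ⟨0, ?_⟩ (Or.inl ⟨⟨hT, le_rfl⟩, by simp [hω]⟩)
  rintro t (⟨⟨h0, -⟩, -⟩ | rfl)
  · exact h0
  · linarith

/-- If `X` does not hit zero `Q`-almost surely, then `X_T > 0` `Q`-almost surely. -/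
lemma measure_terminal_eq_zero {Ω : Type*} {F : ℝ → MeasurableSpace Ω} {T : ℝ}
    {X : ℝ → Ω → ℝ≥0∞} {x₀ : ℝ≥0∞} {Q : @Measure Ω (F T)} (hsetup : Setup F T X x₀ Q)
    (hS : Q {ω | St T X ω = T + 1} = 1) : Q {ω | X T ω = 0} = 0 := by
  let _ : MeasurableSpace Ω := F T
  have := hsetup.prob
  have hT := hsetup.T_pos.le
  have hmeas : MeasurableSet {ω | X T ω = 0} :=
    hsetup.adapted T ⟨hT, le_rfl⟩ (measurableSet_singleton 0)
  rw [← prob_compl_eq_one_iff hmeas]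
  refine le_antisymm prob_le_one (hS ▸ measure_mono fun ω hω h0 => ?_)
  have hle := St_le_of_eq_zero hT h0
  rw [mem_ofPred_eq] at hω
  linarith

/-- The numéraire relation at the terminal time. -/
lemma NumeraireRel.measure_terminal_lt_top {Ω : Type*} {F : ℝ → MeasurableSpace Ω} {T : ℝ}
    {X : ℝ → Ω → ℝ≥0∞} {x₀ : ℝ≥0∞} {Q Qh : @Measure Ω (F T)}
    (hnum : NumeraireRel F T X x₀ Q Qh) :
    Qh {ω | X T ω < ⊤} = (∫⁻ ω, X T ω ∂Q) / x₀ := by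
  have h := hnum (fun _ => T + 1)
    ⟨fun t => @MeasurableSet.const _ (F t) _, fun _ => Or.inr rfl⟩ univ
    (fun t => by simpa only [univ_inter] using @MeasurableSet.const _ (F t) _)
  have hT : min (T + 1) T = T := min_eq_right (by linarith)
  simpa only [valueAt, hT, univ_inter, Measure.restrict_univ] using h

/-- A true martingale `X` has `E^Q[X_T] = x₀`. -/
lemma lintegral_terminal_of_isMart {Ω : Type*} {F : ℝ → MeasurableSpace Ω} {T : ℝ}
    {X : ℝ → Ω → ℝ≥0∞} {x₀ : ℝ≥0∞} {Q : @Measure Ω (F T)} (hsetup : Setup F T X x₀ Q)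
    (hX : IsMart F T Q X) : ∫⁻ ω, X T ω ∂Q = x₀ := by
  let _ : MeasurableSpace Ω := F T
  have := hsetup.prob
  have hT := hsetup.T_pos.le
  have hmeas : MeasurableSet {ω | X 0 ω = x₀} :=
    hsetup.mono 0 T hT _ (hsetup.adapted 0 ⟨le_rfl, hT⟩ (measurableSet_singleton x₀))
  have hinit : ∀ᵐ ω ∂Q, X 0 ω = x₀ :=
    (prob_compl_eq_zero_iff hmeas).2 hsetup.init
  have h := hX.2.2 0 T le_rfl hT le_rfl univ (@MeasurableSet.univ _ (F 0))
  rw [Measure.restrict_univ] at h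
  rw [h, lintegral_congr_ae hinit]
  simp

/-- If `X` is a true `Q`-martingale, then `X` is `Q̂`-almost surely finite at time `T`. -/
lemma measure_terminal_eq_top {Ω : Type*} {F : ℝ → MeasurableSpace Ω} {T : ℝ}
    {X : ℝ → Ω → ℝ≥0∞} {x₀ : ℝ≥0∞} {Q Qh : @Measure Ω (F T)} (hsetup : Setup F T X x₀ Q)
    (hQh : IsProbabilityMeasure Qh) (hnum : NumeraireRel F T X x₀ Q Qh)
    (hX : IsMart F T Q X) : Qh {ω | X T ω = ⊤} = 0 := by
  let _ : MeasurableSpace Ω := F T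
  have hmeas : MeasurableSet {ω | X T ω = ⊤} :=
    hsetup.adapted T ⟨hsetup.T_pos.le, le_rfl⟩ (measurableSet_singleton ⊤)
  have hcompl : {ω | X T ω = ⊤}ᶜ = {ω | X T ω < ⊤} := by
    ext ω
    simp [lt_top_iff_ne_top]
  rw [← prob_compl_eq_one_iff hmeas, hcompl, hnum.measure_terminal_lt_top,
    lintegral_terminal_of_isMart hsetup hX,
    ENNReal.div_self hsetup.x₀_pos.ne' hsetup.x₀_lt_top.ne]

/-- Absolutely continuous measures.  (a) If `Q(S = T+1) = 1` then
`p^€((D^$,D^€)) = E^{Q̂}[D^€]` for every contingent claim; (b) if `X` is a true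
`Q`-martingale (equivalently `Q̂(R = T+1) = 1`) then `p^$((D^$,D^€)) = E^Q[D^$]` for
every contingent claim. -/
theorem statement18 {Ω : Type*} (F : ℝ → MeasurableSpace Ω) (T : ℝ)
    (X : ℝ → Ω → ℝ≥0∞) (x₀ : ℝ≥0∞) (Q Qh : @Measure Ω (F T))
    (hsetup : Setup F T X x₀ Q) (hQh : IsProbabilityMeasure Qh)
    (hnum : NumeraireRel F T X x₀ Q Qh) :
    (Q {ω | St T X ω = T + 1} = 1 →
      ∀ Dd De : Ω → ℝ≥0∞, IsClaim F T X Dd De →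
        priceE F T X x₀ Q Qh Dd De = ∫⁻ ω, De ω ∂Qh) ∧
    (IsMart F T Q X →
      ∀ Dd De : Ω → ℝ≥0∞, IsClaim F T X Dd De →
        priceD F T X x₀ Q Qh Dd De = ∫⁻ ω, Dd ω ∂Q) := by
  refine ⟨fun hS Dd De _ => ?_, fun hX Dd De _ => ?_⟩
  · rw [priceE, setLIntegral_measure_zero _ _ (measure_terminal_eq_zero hsetup hS),
      ENNReal.zero_div, add_zero]
  · rw [priceD, setLIntegral_measure_zero _ _ (measure_terminal_eq_top hsetup hQh hnum hX),
      mul_zero, add_zero]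

end Paper
end
end
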